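/- Let X be a locally compact Hausdorff topological space. Then X has the Moving Off Property if and only if the space C_k(X) of continuous real-valued functions on X with the compact-open topology is a Baire space. -/

import Mathlib

open Set Topology

/-- A family of sets indexed by `ι` is *discrete* if every point has a neighborhood
meeting at most one member of the family. -/
def IsDiscreteFamily {ι X : Type*} [TopologicalSpace X] (U : ι → Set X) : Prop :=
  ∀ x : X, ∃ V ∈ nhds x, {i : ι | (U i ∩ V).Nonempty}.Subsingleton

/-- A *moving off collection* for `X`: a family of nonempty compact sets such that every
compact set is disjoint from some member of the family. -/
def IsMovingOff {X : Type*} [TopologicalSpace X] (𝒦 : Set (Set X)) : Prop :=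
  (∀ K ∈ 𝒦, K.Nonempty) ∧ (∀ K ∈ 𝒦, IsCompact K) ∧
    ∀ L : Set X, IsCompact L → ∃ K ∈ 𝒦, Disjoint K L

/-- The *Moving Off Property*: every moving off collection contains an infinite subfamily
of pairwise distinct sets admitting a discrete open expansion. -/
def HasMOP (X : Type*) [TopologicalSpace X] : Prop :=
  ∀ 𝒦 : Set (Set X), IsMovingOff 𝒦 →
    ∃ K : ℕ → Set X, (∀ n, K n ∈ 𝒦) ∧ Function.Injective K ∧
      ∃ U : ℕ → Set X, (∀ n, IsOpen (U n)) ∧ (∀ n, K n ⊆ U n) ∧ IsDiscreteFamily U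

/-- Basic neighborhoods in the compact-open topology contain uniform balls on compacta. -/
lemma ck_exists_ball {X : Type*} [TopologicalSpace X] {O : Set C(X, ℝ)} (hO : IsOpen O)
    {g : C(X, ℝ)} (hg : g ∈ O) :
    ∃ K : Set X, IsCompact K ∧ ∃ δ > 0, ∀ u : C(X, ℝ), (∀ x ∈ K, dist (g x) (u x) < δ) → u ∈ O := by
  have h := (UniformSpace.hasBasis_nhds g)
  obtain ⟨V, ⟨hV, _⟩, hVO⟩ := h.mem_iff.1 (hO.mem_nhds hg)
  obtain ⟨p, hp, hpV⟩ :=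
    (Metric.uniformity_basis_dist (α := ℝ)).compactConvergenceUniformity.mem_iff.1 hV
  refine ⟨p.1, hp.1, p.2, hp.2, fun u hu => hVO ?_⟩
  exact hpV hu

lemma ck_ball_mem_nhds {X : Type*} [TopologicalSpace X] (g : C(X, ℝ)) {K : Set X}
    (hK : IsCompact K) {δ : ℝ} (hδ : 0 < δ) :
    {u : C(X, ℝ) | ∀ x ∈ K, dist (g x) (u x) < δ} ∈ 𝓝 g := by
  have h := (Filter.HasBasis.compactConvergenceUniformity (α := X)
    (Metric.uniformity_basis_dist (α := ℝ))).mem_of_mem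
    (show IsCompact (K, δ).1 ∧ 0 < (K, δ).2 from ⟨hK, hδ⟩)
  exact UniformSpace.ball_mem_nhds g h

lemma discrete_locallyFinite {X : Type*} [TopologicalSpace X] {U : ℕ → Set X}
    (h : IsDiscreteFamily U) : LocallyFinite U := by
  intro x
  obtain ⟨V, hV, hs⟩ := h x
  exact ⟨V, hV, hs.finite⟩

lemma discrete_eq {X : Type*} [TopologicalSpace X] {U : ℕ → Set X}
    (h : IsDiscreteFamily U) {x : X} {i j : ℕ} (hi : x ∈ U i) (hj : x ∈ U j) : i = j := by
  obtain ⟨V, hV, hs⟩ := h x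
  exact hs ⟨x, hi, mem_of_mem_nhds hV⟩ ⟨x, hj, mem_of_mem_nhds hV⟩

lemma baire_imp_mop {X : Type*} [TopologicalSpace X] [T2Space X] [LocallyCompactSpace X]
    (hB : BaireSpace C(X, ℝ)) : HasMOP X := by
  rintro 𝒦 ⟨hne, hcpt, hoff⟩
  let O : ℕ → Set C(X, ℝ) := fun n => {f | ∃ K ∈ 𝒦, MapsTo f K (Ioi (n : ℝ))}
  have hOo : ∀ n, IsOpen (O n) := by
    intro n
    have : O n = ⋃ K ∈ 𝒦, {f : C(X, ℝ) | MapsTo f K (Ioi (n : ℝ))} := by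
      ext f; simp [O]
    rw [this]
    exact isOpen_biUnion fun K hK => ContinuousMap.isOpen_setOfPred_mapsTo (hcpt K hK) isOpen_Ioi
  have hOd : ∀ n, Dense (O n) := by
    intro n
    rw [dense_iff_inter_open]
    rintro W hW ⟨f, hf⟩
    obtain ⟨L, hL, δ, hδ, hball⟩ := ck_exists_ball hW hf
    obtain ⟨K, hK, hKL⟩ := hoff L hL
    obtain ⟨φ, h1, h0, -⟩ := exists_continuous_one_zero_of_isCompact (hcpt K hK) hL.isClosed hKL
    refine ⟨f + φ * (ContinuousMap.const X ((n : ℝ) + 1) - f), hball _ ?_, K, hK, ?_⟩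
    · intro x hx
      have := h0 hx
      simp at this
      simp [this, hδ]
    · intro x hx
      have := h1 hx
      simp at this
      simp [this]
  obtain ⟨f, hf⟩ : (⋂ n, O n).Nonempty := (hB.baire_property O hOo hOd).nonempty
  rw [mem_iInter] at hf
  have key : ∀ a : ℝ, ∃ K ∈ 𝒦, ∃ b : ℝ, ∀ x ∈ K, a < f x ∧ f x < b := by
    intro a
    obtain ⟨n, hn⟩ := exists_nat_gt a
    obtain ⟨K, hK, hm⟩ := hf n
    obtain ⟨b, hb⟩ := (hcpt K hK).bddAbove_image f.continuous.continuousOn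
    refine ⟨K, hK, b + 1, fun x hx => ⟨hn.trans (hm hx), ?_⟩⟩
    have := hb (mem_image_of_mem f hx)
    linarith
  choose Kf hKf bf hbf using key
  let a : ℕ → ℝ := fun n => Nat.rec 0 (fun _ r => max (bf r) r + 1) n
  have ha : ∀ n, a (n + 1) = max (bf (a n)) (a n) + 1 := fun n => rfl
  have hmono : Monotone a := monotone_nat_of_le_succ fun n => by
    rw [ha]; linarith [le_max_right (bf (a n)) (a n)]
  have hlt : ∀ i j, i < j → bf (a i) + 1 ≤ a j := by
    intro i j hij
    have h1 := hmono (Nat.succ_le_of_lt hij)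
    have h2 := ha i
    have := le_max_left (bf (a i)) (a i)
    simp only [Nat.succ_eq_add_one] at h1
    linarith
  refine ⟨fun n => Kf (a n), fun n => hKf _, ?_, fun n => f ⁻¹' Ioo (a n) (bf (a n)),
    fun n => isOpen_Ioo.preimage f.continuous, fun n x hx => hbf _ x hx, ?_⟩
  · have aux : ∀ i j, i < j → Kf (a i) ≠ Kf (a j) := by
      intro i j hij he
      obtain ⟨x, hx⟩ := hne _ (hKf (a i))
      have h1 := hbf _ x hx
      have h2 := hbf _ x (he ▸ hx)
      linarith [hlt i j hij]
    intro i j he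
    rcases lt_trichotomy i j with h | h | h
    · exact absurd he (aux _ _ h)
    · exact h
    · exact absurd he.symm (aux _ _ h)
  · intro x
    refine ⟨f ⁻¹' Metric.ball (f x) (1/2),
      f.continuous.continuousAt.preimage_mem_nhds (Metric.ball_mem_nhds _ (by norm_num)), ?_⟩
    have aux : ∀ i j, i < j → (f ⁻¹' Ioo (a i) (bf (a i)) ∩ f ⁻¹' Metric.ball (f x) (1/2)).Nonempty →
        (f ⁻¹' Ioo (a j) (bf (a j)) ∩ f ⁻¹' Metric.ball (f x) (1/2)).Nonempty → False := by
      rintro i j hij ⟨y, ⟨_, hy⟩, hy'⟩ ⟨z, ⟨hz, _⟩, hz'⟩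
      simp only [mem_preimage, Metric.mem_ball, Real.dist_eq, abs_lt] at hy' hz'
      linarith [hlt i j hij]
    intro i hi j hj
    rcases lt_trichotomy i j with h | h | h
    · exact (aux _ _ h hi hj).elim
    · exact h
    · exact (aux _ _ h hj hi).elim

/-- The game lemma: in a space with MOP, any infinite game in which one can always answer
outside a prescribed compact set has a run whose answers are locally finite. -/
lemma mop_game {X : Type*} [TopologicalSpace X] (hX : HasMOP X) {S : Type*}
    (Step : S → S → Set X → Prop)
    (hstep : ∀ s, ∀ L : Set X, IsCompact L → ∃ s' M, Step s s' M ∧ IsCompact M ∧ Disjoint M L)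
    (s0 : S) :
    ∃ (s : ℕ → S) (M : ℕ → Set X), s 0 = s0 ∧ (∀ n, Step (s n) (s (n + 1)) (M n)) ∧
      LocallyFinite M := by
  by_cases hc : IsCompact (univ : Set X)
  · have h2 : ∀ s, ∃ s', Step s s' ∅ := by
      intro s
      obtain ⟨s', M, h, -, hd⟩ := hstep s univ hc
      have : M = ∅ := by simpa using hd
      exact ⟨s', this ▸ h⟩
    choose nx hnx using h2
    refine ⟨fun n => nx^[n] s0, fun _ => ∅, rfl, fun n => ?_, ?_⟩
    · simp only [Function.iterate_succ_apply']; exact hnx _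
    · intro x; exact ⟨univ, Filter.univ_mem, by simp⟩
  -- children
  have hch : ∀ s, ∃ (c : ℕ → S) (M N : ℕ → Set X), (∀ i, Step s (c i) (M i)) ∧
      (∀ i, M i ⊆ N i) ∧ (∀ i, (N i).Nonempty) ∧ (∀ i, IsCompact (N i)) ∧ LocallyFinite N := by
    intro s
    obtain ⟨N, hN, -, U, -, hNU, hU⟩ := hX
      {N | N.Nonempty ∧ IsCompact N ∧ ∃ s' M, Step s s' M ∧ M ⊆ N} (by
        refine ⟨fun K hK => hK.1, fun K hK => hK.2.1, fun L hL => ?_⟩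
        obtain ⟨s', M, h, hM, hd⟩ := hstep s L hL
        obtain ⟨x, hx⟩ : ∃ x, x ∉ L := by
          by_contra hcon
          push Not at hcon
          exact hc ((eq_univ_of_forall hcon) ▸ hL)
        refine ⟨insert x M, ⟨insert_nonempty _ _, hM.insert x, s', M, h, subset_insert _ _⟩, ?_⟩
        exact disjoint_insert_left.2 ⟨hx, hd⟩)
    choose hne hcp c M hs hsub using hN
    exact ⟨c, M, N, hs, hsub, hne, hcp, (discrete_locallyFinite hU).subset hNU⟩
  choose c M N hs hsub hne hcp hlf using hch
  -- enumeration of the countable tree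
  let node : List ℕ → S := fun l => List.rec s0 (fun i _ r => c r i) l
  obtain ⟨t, ht⟩ := exists_surjective_nat (List ℕ)
  let e : ℕ → S := fun j => node (t j)
  have he0 : ∃ j, e j = s0 := by
    obtain ⟨j, hj⟩ := ht []
    exact ⟨j, by simp only [e, hj]; rfl⟩
  have hec : ∀ j i, ∃ j', e j' = c (e j) i := by
    intro j i
    obtain ⟨j', hj⟩ := ht (i :: t j)
    exact ⟨j', by simp only [e, hj]; rfl⟩
  let E : (ℕ → ℕ) → Set X := fun i => ⋃ j ∈ Finset.range (i 0 + 1), N (e j) (i j)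
  obtain ⟨F, hF, -, U, -, hFU, hU⟩ := hX (range E) (by
    refine ⟨?_, ?_, ?_⟩
    · rintro _ ⟨i, rfl⟩
      obtain ⟨x, hx⟩ := hne (e 0) (i 0)
      exact ⟨x, mem_biUnion (x := 0) (by simp) hx⟩
    · rintro _ ⟨i, rfl⟩
      exact (Finset.range (i 0 + 1)).isCompact_biUnion fun j _ => hcp _ _
    · intro L hL
      have : ∀ j, ∃ i, Disjoint (N (e j) i) L := by
        intro j
        have hfin := (hlf (e j)).finite_nonempty_inter_compact hL
        obtain ⟨i, hi⟩ := hfin.exists_notMem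
        refine ⟨i, ?_⟩
        rw [disjoint_iff_inter_eq_empty]
        simpa [not_nonempty_iff_eq_empty] using hi
      choose i hi using this
      refine ⟨E i, ⟨i, rfl⟩, ?_⟩
      simp only [E, disjoint_iUnion_left]
      exact fun j _ => hi j)
  choose ii hii using hF
  have hsubU : ∀ k j, j ≤ ii k 0 → N (e j) (ii k j) ⊆ U k := by
    intro k j hj
    refine Subset.trans ?_ (hFU k)
    rw [← hii k]
    exact subset_biUnion_of_mem (u := fun j => N (e j) (ii k j))
      (show j ∈ (Finset.range (ii k 0 + 1)) by simp; omega)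
  have hinj : Function.Injective fun k => ii k 0 := by
    intro k l hkl
    simp only at hkl
    obtain ⟨x, hx⟩ := hne (e 0) (ii k 0)
    exact discrete_eq hU (hsubU k 0 (Nat.zero_le _) hx)
      (hsubU l 0 (Nat.zero_le _) (hkl ▸ hx))
  have hnext : ∀ p : ℕ × ℕ, ∃ q : ℕ × ℕ, p.2 < q.2 ∧ p.1 ≤ ii q.2 0 ∧
      e q.1 = c (e p.1) (ii q.2 p.1) := by
    rintro ⟨j, k⟩
    obtain ⟨k', h1, h2⟩ := ((hinj.nat_tendsto_atTop.eventually_ge_atTop j).and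
      (Filter.eventually_gt_atTop k)).exists
    obtain ⟨j', hj'⟩ := hec j (ii k' j)
    exact ⟨(j', k'), h2, h1, hj'⟩
  choose nx hn1 hn2 hn3 using hnext
  obtain ⟨j0, hj0⟩ := he0
  let p : ℕ → ℕ × ℕ := fun n => nx^[n] (j0, 0)
  have hp : ∀ n, p (n + 1) = nx (p n) := fun n => Function.iterate_succ_apply' _ _ _
  refine ⟨fun n => e (p n).1, fun n => M (e (p n).1) (ii (p (n + 1)).2 (p n).1), hj0, ?_, ?_⟩
  · intro n
    have h3 := hn3 (p n)
    rw [← hp] at h3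
    simp only [h3]
    exact hs _ _
  · have hk : StrictMono fun n => (p (n + 1)).2 := strictMono_nat_of_lt_succ fun n => by
      rw [hp (n + 1)]; exact hn1 _
    refine ((discrete_locallyFinite hU).comp_injective hk.injective).subset fun n => ?_
    refine (hsub _ _).trans (hsubU _ _ ?_)
    rw [hp]; exact hn2 _

/-- States of the game used for the Baire property. -/
structure CkState (X : Type*) [TopologicalSpace X] (O : ℕ → Set C(X, ℝ)) where
  n : ℕ
  f : C(X, ℝ)
  K : Set X
  ε : ℝ
  hK : IsCompact K
  hε : 0 < ε
  good : ∀ u : C(X, ℝ), (∀ x ∈ K, dist (f x) (u x) ≤ ε) → u ∈ O n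

lemma ck_step {X : Type*} [TopologicalSpace X] [T2Space X] [LocallyCompactSpace X]
    (O : ℕ → Set C(X, ℝ)) (hO : ∀ n, IsOpen (O n)) (hd : ∀ n, Dense (O (n + 1)))
    (s : CkState X O) (L : Set X) (hL : IsCompact L) :
    ∃ (s' : CkState X O) (M : Set X), (s'.n = s.n + 1 ∧ s.K ⊆ s'.K ∧ s'.ε ≤ s.ε / 2 ∧
      (∀ x ∉ M, dist (s.f x) (s'.f x) ≤ s.ε / 2) ∧ Disjoint s.K M) ∧
      IsCompact M ∧ Disjoint M L := by
  obtain ⟨L', hL', hsub⟩ := exists_compact_superset (hL.union s.hK)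
  have hε := s.hε
  obtain ⟨g, hgO, hg⟩ := (hd s.n).inter_nhds_nonempty
    (ck_ball_mem_nhds s.f hL' (half_pos s.hε))
  obtain ⟨K1, hK1, δ, hδ, hball⟩ := ck_exists_ball (hO _) hgO
  obtain ⟨φ, h1, -, hcs, hI⟩ := exists_continuous_one_zero_of_isCompact
    (hK1.union s.hK) isClosed_empty (disjoint_empty _)
  refine ⟨⟨s.n + 1, s.f + φ * (g - s.f), K1 ∪ s.K, min (δ / 2) (s.ε / 2), hK1.union s.hK,
    by positivity, ?_⟩, tsupport φ \ interior L', ⟨rfl, subset_union_right, min_le_right _ _,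
      ?_, ?_⟩, ?_, ?_⟩
  · intro u hu
    refine hball u fun x hx => ?_
    have h2 := hu x (Or.inl hx)
    have h3 : φ x = 1 := h1 (Or.inl hx)
    simp only [ContinuousMap.add_apply, ContinuousMap.mul_apply, ContinuousMap.sub_apply, h3] at h2
    have h4 : s.f x + 1 * (g x - s.f x) = g x := by ring
    rw [h4] at h2
    linarith [h2.trans (min_le_left _ _)]
  · intro x hx
    by_cases hxL : x ∈ interior L'
    · have h2 : dist (s.f x) (g x) < s.ε / 2 := hg x (interior_subset hxL)
      have h3 := hI x
      simp only [ContinuousMap.add_apply, ContinuousMap.mul_apply, ContinuousMap.sub_apply]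
      rw [Real.dist_eq] at h2 ⊢
      have h4 : s.f x - (s.f x + φ x * (g x - s.f x)) = φ x * (s.f x - g x) := by ring
      rw [h4, abs_mul, abs_of_nonneg h3.1]
      nlinarith [abs_nonneg (s.f x - g x), h3.1, h3.2]
    · have h2 : x ∉ tsupport φ := fun h => hx ⟨h, hxL⟩
      have h3 : φ x = 0 := image_eq_zero_of_notMem_tsupport h2
      simp [h3]
      positivity
  · rw [Set.disjoint_left]
    exact fun x hx hx' => hx'.2 (hsub (Or.inr hx))
  · exact IsCompact.diff hcs isOpen_interior
  · rw [Set.disjoint_left]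
    exact fun x hx hx' => hx.2 (hsub (Or.inl hx'))

lemma mop_imp_baire {X : Type*} [TopologicalSpace X] [T2Space X] [LocallyCompactSpace X]
    (hX : HasMOP X) : BaireSpace C(X, ℝ) := by
  refine ⟨fun O' hO' hd' => ?_⟩
  rw [dense_iff_inter_open]
  rintro W hW ⟨f0, hf0⟩
  let O : ℕ → Set C(X, ℝ) := fun n => Nat.casesOn n W O'
  have hO : ∀ n, IsOpen (O n) := by
    rintro (_ | n)
    · exact hW
    · exact hO' n
  obtain ⟨K0, hK0, δ, hδ, hball⟩ := ck_exists_ball hW hf0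
  let s0 : CkState X O := ⟨0, f0, K0, δ / 2, hK0, half_pos hδ, fun u hu =>
    hball u fun x hx => (hu x hx).trans_lt (by linarith)⟩
  obtain ⟨s, M, hs0, hs, hlf⟩ := mop_game hX _ (ck_step O hO hd') s0
  have hn : ∀ n, (s n).n = n := by
    intro n
    induction n with
    | zero => rw [hs0]
    | succ k ih => rw [(hs k).1, ih]
  have hKm : Monotone fun n => (s n).K := monotone_nat_of_le_succ fun n => (hs n).2.1
  -- main estimate
  have hest : ∀ x n, (∀ k ≥ n, x ∉ M k) → ∀ m, n ≤ m →
      dist ((s n).f x) ((s m).f x) ≤ (s n).ε - (s m).ε := by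
    intro x n hx m hnm
    induction m, hnm using Nat.le_induction with
    | base => simp
    | succ k hk ih =>
      have h1 := (hs k).2.2.2.1 x (hx k hk)
      have h2 := (hs k).2.2.1
      have h3 := dist_triangle ((s n).f x) ((s k).f x) ((s (k + 1)).f x)
      linarith
  have hε0 : ∀ n, (s n).ε ≤ δ / 2 * (1 / 2) ^ n := by
    intro n
    induction n with
    | zero => rw [hs0]; simp [s0]
    | succ k ih =>
      have := (hs k).2.2.1
      rw [pow_succ]; linarith
  have hεt : Filter.Tendsto (fun n => (s n).ε) Filter.atTop (𝓝 0) := by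
    have h := (tendsto_pow_atTop_nhds_zero_of_lt_one (r := (1 / 2 : ℝ)) (by norm_num)
      (by norm_num)).const_mul (δ / 2)
    rw [mul_zero] at h
    exact squeeze_zero (fun n => (s n).hε.le) hε0 h
  have htail : ∀ x, ∃ V ∈ 𝓝 x, ∃ n0, ∀ y ∈ V, ∀ k ≥ n0, y ∉ M k := by
    intro x
    obtain ⟨V, hV, hfin⟩ := hlf x
    obtain ⟨b, hb⟩ := hfin.bddAbove
    refine ⟨V, hV, b + 1, fun y hy k hk hyM => ?_⟩
    have := hb (show k ∈ {i | (M i ∩ V).Nonempty} from ⟨y, hyM, hy⟩)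
    omega
  have hlim : ∀ x, ∃ l, Filter.Tendsto (fun n => (s n).f x) Filter.atTop (𝓝 l) := by
    intro x
    obtain ⟨V, hV, n0, h⟩ := htail x
    apply cauchySeq_tendsto_of_complete
    rw [Metric.cauchySeq_iff']
    intro ε hε
    obtain ⟨n, hnε, hnn⟩ := ((hεt.eventually_lt_const hε).and
      (Filter.eventually_ge_atTop n0)).exists
    refine ⟨n, fun m hm => ?_⟩
    have := hest x n (fun k hk => h x (mem_of_mem_nhds hV) k (hnn.trans hk)) m hm
    rw [dist_comm]
    linarith [(s m).hε]
  choose F hF using hlim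
  have hestF : ∀ x n, (∀ k ≥ n, x ∉ M k) → dist ((s n).f x) (F x) ≤ (s n).ε := by
    intro x n hx
    refine le_of_tendsto ((tendsto_const_nhds).dist (hF x)) ?_
    filter_upwards [Filter.eventually_ge_atTop n] with m hm
    linarith [hest x n hx m hm, (s m).hε]
  have hFc : Continuous F := by
    have : TendstoLocallyUniformly (fun n x => (s n).f x) F Filter.atTop := by
      rw [Metric.tendstoLocallyUniformly_iff]
      intro ε hε x
      obtain ⟨V, hV, n0, h⟩ := htail x
      refine ⟨V, hV, ?_⟩
      filter_upwards [hεt.eventually_lt_const hε, Filter.eventually_ge_atTop n0] with n h1 h2 y hy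
      rw [dist_comm]
      exact (hestF y n fun k hk => h y hy k (h2.trans hk)).trans_lt h1
    exact this.continuous (Filter.Frequently.of_forall fun n => (s n).f.continuous)
  have hmem : ∀ n, (⟨F, hFc⟩ : C(X, ℝ)) ∈ O n := by
    intro n
    have := (s n).good ⟨F, hFc⟩ (fun x hx => hestF x n fun k hk hxM =>
      Set.disjoint_left.1 (hs k).2.2.2.2 (hKm hk hx) hxM)
    rwa [hn n] at this
  exact ⟨⟨F, hFc⟩, hmem 0, mem_iInter.2 fun n => hmem (n + 1)⟩

/-- Gruenhage and Ma: a locally compact Hausdorff space has the Moving Off Property iff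
`C_k(X)` is a Baire space. -/
theorem mop_iff_ck_baire (X : Type*) [TopologicalSpace X] [T2Space X] [LocallyCompactSpace X] :
    HasMOP X ↔ BaireSpace C(X, ℝ) :=
  ⟨mop_imp_baire, baire_imp_mop⟩
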